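/- arXiv:math/0701518 — 6 statements merged into one kernel-verified Lean document; each statement's English description precedes it below -/
import Mathlib

section
/- Let n ≥ 2, let d ≥ n, and let v_1, …, v_d ∈ ℝⁿ be vectors each of whose first coordinate equals 1 (i.e. v_a = (1, w_a) with w_a ∈ ℝ^{n-1}). Set C* = {y ∈ ℝⁿ : ⟨y, v_a⟩ ≥ 0 for all a = 1,…,d}, assume C* has nonempty interior and C* ∩ (−C*) = {0}, and let C be the dual cone of C*. Let N_int = {ξ ∈ interior(C) : ⟨ξ, e₁⟩ = n}, where e₁ is the first standard basis vector. Then there exists a unique ξ* ∈ N_int such that vol(Δ(ξ*)) < vol(Δ(ξ)) for every ξ ∈ N_int with ξ ≠ ξ*; i.e. the Euclidean volume of Δ(·) has a unique minimizer (equivalently, a unique critical point) on N_int. -/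
open MeasureTheory RealInnerProductSpace Pointwise

/-- The constant relating the Laplace transform of a cone to the volume. -/
noncomputable def lapConst (n : ℕ) : ENNReal :=
  ∫⁻ t in Set.Ioi (0:ℝ), ENNReal.ofReal (Real.exp (-t)) * ENNReal.ofReal |(2 * t) ^ n|

lemma lapConst_ne_top (n : ℕ) : lapConst n ≠ ⊤ := by
  have h := Real.GammaIntegral_convergent (s := (n:ℝ) + 1) (by positivity)
  have h2 : IntegrableOn (fun t : ℝ => Real.exp (-t) * |(2 * t) ^ n|) (Set.Ioi 0) volume := by
    refine IntegrableOn.congr_fun (h.const_mul (2 ^ n)) ?_ measurableSet_Ioi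
    intro t ht
    have ht' : (0:ℝ) < t := ht
    have : |(2 * t) ^ n| = 2 ^ n * t ^ n := by rw [abs_of_pos (by positivity), mul_pow]
    simp only [this, add_sub_cancel_right, Real.rpow_natCast]
    ring
  have h3 := h2.lintegral_lt_top
  unfold lapConst
  convert h3.ne using 3 with t
  rw [ENNReal.ofReal_mul (Real.exp_pos _).le]

lemma lapConst_ne_zero (n : ℕ) : lapConst n ≠ 0 := by
  refine ne_of_gt ?_
  unfold lapConst
  rw [setLIntegral_pos_iff (by fun_prop)]
  have : Set.Ioi (0:ℝ) ⊆ Function.support (fun t : ℝ =>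
    ENNReal.ofReal (Real.exp (-t)) * ENNReal.ofReal |(2 * t) ^ n|) := by
    intro t ht
    have ht' : (0:ℝ) < t := ht
    have h1 : 0 < |(2 * t) ^ n| := abs_pos.2 (by positivity)
    simp [Real.exp_pos, ht'.ne']
  rw [Set.inter_eq_self_of_subset_right this]
  simp

lemma lintegral_exp_tail (s : ℝ) (hs : 0 ≤ s) :
    ∫⁻ t in Set.Ioi (0:ℝ), (Set.Ici s).indicator (fun t => ENNReal.ofReal (Real.exp (-t))) t
      = ENNReal.ofReal (Real.exp (-s)) := by
  rw [lintegral_indicator measurableSet_Ici, Measure.restrict_restrict measurableSet_Ici]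
  have h1 : (Set.Ici s ∩ Set.Ioi 0 : Set ℝ) =ᵐ[volume] Set.Ioi s := by
    have := (Ioi_ae_eq_Ici (μ := volume) (a := s)).symm.inter
      (Filter.EventuallyEq.refl (ae volume) (Set.Ioi (0:ℝ)))
    rwa [Set.inter_eq_self_of_subset_left (Set.Ioi_subset_Ioi hs)] at this
  rw [Measure.restrict_congr_set h1, ← ofReal_integral_eq_lintegral_ofReal
    (integrableOn_exp_neg_Ioi s) (Filter.Eventually.of_forall fun _ => (Real.exp_pos _).le),
    integral_exp_neg_Ioi]

section

variable {n : ℕ}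

/-- The Laplace transform of a set. -/
noncomputable def lap (D : Set (EuclideanSpace ℝ (Fin n))) (ξ : EuclideanSpace ℝ (Fin n)) :
    ENNReal := ∫⁻ y in D, ENNReal.ofReal (Real.exp (-⟪ξ, y⟫))

lemma lap_eq {D : Set (EuclideanSpace ℝ (Fin n))} (hD : MeasurableSet D)
    (hs : ∀ r : ℝ, 0 < r → ∀ y ∈ D, r • y ∈ D) (ξ : EuclideanSpace ℝ (Fin n))
    (hξ : ∀ y ∈ D, 0 ≤ ⟪ξ, y⟫) :
    lap D ξ = lapConst n * volume {y ∈ D | ⟪ξ, y⟫ ≤ 1 / 2} := by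
  have e1 : lap D ξ = ∫⁻ y in D, ∫⁻ t in Set.Ioi (0:ℝ),
      (Set.Ici ⟪ξ, y⟫).indicator (fun t => ENNReal.ofReal (Real.exp (-t))) t := by
    refine setLIntegral_congr_fun hD fun y hy => ?_
    exact (lintegral_exp_tail _ (hξ y hy)).symm
  rw [e1, lintegral_lintegral_swap, lapConst, ← lintegral_mul_const _ (by fun_prop)]
  · refine setLIntegral_congr_fun measurableSet_Ioi fun t ht => ?_
    have ht' : (0:ℝ) < t := ht
    have hm : MeasurableSet {y : EuclideanSpace ℝ (Fin n) | ⟪ξ, y⟫ ≤ t} :=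
      measurableSet_le (by fun_prop) measurable_const
    have e2 : ∀ y : EuclideanSpace ℝ (Fin n),
        (Set.Ici ⟪ξ, y⟫).indicator (fun t => ENNReal.ofReal (Real.exp (-t))) t
        = ({y | ⟪ξ, y⟫ ≤ t} : Set (EuclideanSpace ℝ (Fin n))).indicator
            (fun _ => ENNReal.ofReal (Real.exp (-t))) y := by
      intro y
      simp [Set.indicator]
    simp only [e2]
    rw [lintegral_indicator hm, lintegral_const, Measure.restrict_restrict hm,
      Measure.restrict_apply_univ, mul_assoc]
    congr 1
    have e3 : {y : EuclideanSpace ℝ (Fin n) | ⟪ξ, y⟫ ≤ t} ∩ D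
        = (2 * t) • {y ∈ D | ⟪ξ, y⟫ ≤ 1 / 2} := by
      ext y
      rw [Set.mem_smul_set_iff_inv_smul_mem₀ (by positivity)]
      simp only [Set.mem_inter_iff, Set.mem_ofPred_eq, inner_smul_right]
      have e4 : (2 * t)⁻¹ * ⟪ξ, y⟫ ≤ 1 / 2 ↔ ⟪ξ, y⟫ ≤ t := by
        rw [inv_mul_le_iff₀ (by positivity)]
        constructor <;> intro h <;> linarith
      rw [e4]
      constructor
      · rintro ⟨h1, h2⟩
        exact ⟨hs _ (by positivity) _ h2, h1⟩
      · rintro ⟨h1, h2⟩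
        refine ⟨h2, ?_⟩
        have := hs (2 * t) (by positivity) _ h1
        rwa [smul_inv_smul₀ (by positivity)] at this
    rw [e3, Measure.addHaar_smul, finrank_euclideanSpace_fin]
  · have : Function.uncurry (fun (y : EuclideanSpace ℝ (Fin n)) (t : ℝ) =>
      (Set.Ici ⟪ξ, y⟫).indicator (fun t => ENNReal.ofReal (Real.exp (-t))) t)
      = ({p | ⟪ξ, p.1⟫ ≤ p.2} : Set (EuclideanSpace ℝ (Fin n) × ℝ)).indicator
        (fun p => ENNReal.ofReal (Real.exp (-p.2))) := by
      ext p
      simp [Set.indicator, Function.uncurry]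
    rw [this]
    refine (Measurable.indicator (by fun_prop) ?_).aemeasurable
    exact measurableSet_le (by fun_prop) (by fun_prop)

lemma lap_lsc (D : Set (EuclideanSpace ℝ (Fin n))) : LowerSemicontinuous (lap D) := by
  rw [lowerSemicontinuous_iff_le_liminf]
  intro ξ
  refine le_trans (le_of_eq ?_) (lintegral_liminf_le (μ := volume.restrict D) (u := nhds ξ)
    (f := fun ξ y => ENNReal.ofReal (Real.exp (-⟪ξ, y⟫))) (fun ξ => by fun_prop))
  refine lintegral_congr fun y => (Filter.Tendsto.liminf_eq ?_).symm
  have : Continuous fun ξ : EuclideanSpace ℝ (Fin n) => ENNReal.ofReal (Real.exp (-⟪ξ, y⟫)) :=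
    ENNReal.continuous_ofReal.comp (by fun_prop)
  exact this.tendsto ξ

lemma lap_strict {D : Set (EuclideanSpace ℝ (Fin n))} (hD : MeasurableSet D)
    (hD0 : volume D ≠ 0) {ξ η : EuclideanSpace ℝ (Fin n)} (hne : ξ ≠ η)
    (hfin : lap D ((1/2 : ℝ) • ξ + (1/2 : ℝ) • η) ≠ ⊤) :
    lap D ((1/2 : ℝ) • ξ + (1/2 : ℝ) • η) + lap D ((1/2 : ℝ) • ξ + (1/2 : ℝ) • η)
      < lap D ξ + lap D η := by
  unfold lap at *
  rw [← lintegral_add_left (by fun_prop), ← lintegral_add_left (by fun_prop)]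
  refine setLIntegral_strict_mono hD hD0 (by fun_prop) ?_ ?_
  · rw [lintegral_add_left (by fun_prop)]
    exact ENNReal.add_ne_top.2 ⟨hfin, hfin⟩
  · have hnull : volume ((LinearMap.ker (innerSL ℝ (ξ - η)).toLinearMap :
        Submodule ℝ (EuclideanSpace ℝ (Fin n))) : Set (EuclideanSpace ℝ (Fin n))) = 0 := by
      refine Measure.addHaar_submodule _ _ fun h => hne ?_
      have : ξ - η ∈ (LinearMap.ker (innerSL ℝ (ξ - η)).toLinearMap :
        Submodule ℝ (EuclideanSpace ℝ (Fin n))) := by rw [h]; trivial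
      rw [LinearMap.mem_ker] at this
      have h' : ⟪ξ - η, ξ - η⟫ = 0 := this
      exact sub_eq_zero.1 (inner_self_eq_zero.1 h')
    filter_upwards [measure_eq_zero_iff_ae_notMem.1 hnull] with y hy _
    have hy' : -⟪ξ, y⟫ ≠ -⟪η, y⟫ := by
      intro h
      apply hy
      change ⟪ξ - η, y⟫ = 0
      rw [inner_sub_left]; linarith
    have hc := (And.right strictConvexOn_exp) (Set.mem_univ (-⟪ξ, y⟫))
      (Set.mem_univ (-⟪η, y⟫)) hy' (show (0:ℝ) < 1/2 by norm_num) (show (0:ℝ) < 1/2 by norm_num)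
      (by norm_num)
    simp only [smul_eq_mul] at hc
    have e : -⟪(1/2 : ℝ) • ξ + (1/2 : ℝ) • η, y⟫ = 1/2 * -⟪ξ, y⟫ + 1/2 * -⟪η, y⟫ := by
      rw [inner_add_left, real_inner_smul_left, real_inner_smul_left]; ring
    rw [e, ← ENNReal.ofReal_add (Real.exp_pos _).le (Real.exp_pos _).le,
      ← ENNReal.ofReal_add (Real.exp_pos _).le (Real.exp_pos _).le,
      ENNReal.ofReal_lt_ofReal_iff (by positivity)]
    linarith

/-- If `ξ` vanishes on a ray of a pointed closed cone, `Δ(ξ)` has zero or infinite volume. -/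
lemma vol_top {D : Set (EuclideanSpace ℝ (Fin n))} (hD : IsClosed D)
    (hs : ∀ r : ℝ, 0 < r → ∀ y ∈ D, r • y ∈ D) (ha : ∀ x ∈ D, ∀ y ∈ D, x + y ∈ D)
    {ξ y0 : EuclideanSpace ℝ (Fin n)} (hy0 : y0 ∈ D) (hy0' : -y0 ∉ D) (h0 : ⟪ξ, y0⟫ = 0)
    (hpos : volume {y ∈ D | ⟪ξ, y⟫ ≤ 1 / 2} ≠ 0) :
    volume {y ∈ D | ⟪ξ, y⟫ ≤ 1 / 2} = ⊤ := by
  by_contra hfin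
  apply hpos
  set A := {y ∈ D | ⟪ξ, y⟫ ≤ 1 / 2} with hA
  have hAm : MeasurableSet A := hD.measurableSet.inter
    (measurableSet_le (f := fun y => ⟪ξ, y⟫) (g := fun _ => 1 / 2) (by fun_prop) measurable_const)
  let P : ℕ → Set (EuclideanSpace ℝ (Fin n)) := fun k => (fun y => y + (-((k:ℝ) + 1) • y0)) ⁻¹' A
  have hPA : ∀ k, P k ⊆ A := by
    intro k y hy
    obtain ⟨h1, h2⟩ := hy
    have h3 := ha _ h1 _ (hs ((k:ℝ)+1) (by positivity) _ hy0)
    have e : y + (-((k:ℝ) + 1) • y0) + ((k:ℝ) + 1) • y0 = y := by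
      rw [neg_smul, neg_add_cancel_right]
    refine ⟨e ▸ h3, ?_⟩
    simpa [inner_add_right, inner_smul_right, h0] using h2
  have hPm : ∀ k, MeasurableSet (P k) := fun k => hAm.preimage (by fun_prop)
  have hdiff : ∀ k, volume (A \ P k) = 0 := by
    intro k
    have e : volume (P k) = volume A := measure_preimage_add_right _ _ _
    rw [measure_sdiff (hPA k) (hPm k).nullMeasurableSet (by rw [e]; exact hfin), e, tsub_self]
  have hcov : A ⊆ ⋃ k, A \ P k := by
    intro y hy
    by_contra hcon
    simp only [Set.mem_iUnion, Set.mem_sdiff, not_exists, not_and, not_not] at hcon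
    apply hy0'
    have hlim : Filter.Tendsto (fun k : ℕ => ((1:ℝ) / ((k:ℝ) + 1)) • y + - y0) Filter.atTop
        (nhds ((0:ℝ) • y + -y0)) :=
      (tendsto_one_div_add_atTop_nhds_zero_nat.smul_const y).add_const _
    rw [zero_smul, zero_add] at hlim
    refine hD.mem_of_tendsto hlim (Filter.Eventually.of_forall fun k => ?_)
    have h1 := hs ((1:ℝ) / ((k:ℝ) + 1)) (by positivity) _ (hcon k hy).1
    have hk : ((k:ℝ) + 1) ≠ 0 := by positivity
    convert h1 using 1
    simp only [smul_add, smul_smul]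
    congr 1
    rw [mul_neg, one_div, inv_mul_cancel₀ hk, neg_one_smul]
  exact measure_mono_null hcov (measure_iUnion_null hdiff)

/-- Linear lower bound from interior membership. -/
lemma inner_ge_of_interior {D : Set (EuclideanSpace ℝ (Fin n))} {x : EuclideanSpace ℝ (Fin n)}
    (hx : x ∈ interior D) : ∃ ε : ℝ, 0 < ε ∧ ∀ ξ : EuclideanSpace ℝ (Fin n),
      (∀ y ∈ D, 0 ≤ ⟪ξ, y⟫) → ε * ‖ξ‖ ≤ ⟪ξ, x⟫ := by
  obtain ⟨ε, hε, hb⟩ := Metric.mem_nhds_iff.1 (mem_interior_iff_mem_nhds.1 hx)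
  refine ⟨ε / 2, by positivity, fun ξ hξ => ?_⟩
  rcases eq_or_ne ξ 0 with rfl | h0
  · simp
  have hn0 : 0 < ‖ξ‖ := norm_pos_iff.2 h0
  have h1 : x - (ε / 2 / ‖ξ‖) • ξ ∈ D := by
    apply hb
    rw [Metric.mem_ball, dist_eq_norm, sub_sub_cancel_left, norm_neg, norm_smul,
      Real.norm_of_nonneg (by positivity), div_mul_cancel₀ _ hn0.ne']
    linarith
  have h2 := hξ _ h1
  rw [inner_sub_right, inner_smul_right, real_inner_self_eq_norm_sq] at h2
  have h3 : ε / 2 / ‖ξ‖ * ‖ξ‖ ^ 2 = ε / 2 * ‖ξ‖ := by field_simp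
  linarith

lemma mem_interior_dual {D : Set (EuclideanSpace ℝ (Fin n))} (hD : IsClosed D)
    (hs : ∀ r : ℝ, 0 < r → ∀ y ∈ D, r • y ∈ D) {ξ : EuclideanSpace ℝ (Fin n)}
    (hξ : ∀ y ∈ D, y ≠ 0 → 0 < ⟪ξ, y⟫) : ξ ∈ interior {ξ | ∀ y ∈ D, 0 ≤ ⟪ξ, y⟫} := by
  have hK : IsCompact (Metric.sphere (0 : EuclideanSpace ℝ (Fin n)) 1 ∩ D) :=
    (isCompact_sphere _ _).inter_right hD
  obtain ⟨m, hm, hmin⟩ : ∃ m : ℝ, 0 < m ∧ ∀ y ∈ D, ‖y‖ = 1 → m ≤ ⟪ξ, y⟫ := by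
    rcases (Metric.sphere (0 : EuclideanSpace ℝ (Fin n)) 1 ∩ D).eq_empty_or_nonempty with he | hne
    · refine ⟨1, one_pos, fun y hy h1 => ?_⟩
      have : y ∈ Metric.sphere (0 : EuclideanSpace ℝ (Fin n)) 1 ∩ D := ⟨by simpa using h1, hy⟩
      rw [he] at this
      exact this.elim
    · obtain ⟨y0, hy0, hmin⟩ := hK.exists_isMinOn hne
        (f := fun y => ⟪ξ, y⟫) (by fun_prop)
      refine ⟨⟪ξ, y0⟫, hξ _ hy0.2 ?_, fun y hy h1 => hmin ⟨by simpa using h1, hy⟩⟩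
      rintro rfl
      simpa using hy0.1
  rw [mem_interior_iff_mem_nhds, Metric.mem_nhds_iff]
  refine ⟨m, hm, fun η hη y hy => ?_⟩
  rcases eq_or_ne y 0 with rfl | h0
  · simp
  have hn0 : 0 < ‖y‖ := norm_pos_iff.2 h0
  have h1 := hmin _ (hs ‖y‖⁻¹ (by positivity) _ hy)
    (by rw [norm_smul, norm_inv, norm_norm, inv_mul_cancel₀ hn0.ne'])
  rw [inner_smul_right, le_inv_mul_iff₀ hn0] at h1
  have h2 : |⟪η - ξ, y⟫| ≤ ‖η - ξ‖ * ‖y‖ := abs_real_inner_le_norm _ _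
  have h3 : ‖η - ξ‖ * ‖y‖ ≤ m * ‖y‖ :=
    mul_le_mul_of_nonneg_right (by rw [← dist_eq_norm]; exact (Metric.mem_ball.1 hη).le) hn0.le
  have h4 := neg_abs_le ⟪η - ξ, y⟫
  rw [inner_sub_left] at h4 h2
  linarith

end

/-- For an affine toric Gorenstein singularity (generators `v a` with first
coordinate `1`), the Euclidean volume of `Δ(ξ) = {y ∈ C* | ⟪ξ, y⟫ ≤ 1/2}` has a unique
minimizer on the slice `N_int = {ξ ∈ interior C | ⟪ξ, e₁⟫ = n}` of the dual cone `C`. -/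
theorem unique_volume_minimizer_on_reeb_slice
    (n d : ℕ) (hn : 2 ≤ n) (hd : n ≤ d)
    (v : Fin d → EuclideanSpace ℝ (Fin n))
    (hv : ∀ a : Fin d, v a ⟨0, by omega⟩ = 1)
    (Cstar : Set (EuclideanSpace ℝ (Fin n)))
    (hCstar : Cstar = {y | ∀ a : Fin d, 0 ≤ ⟪y, v a⟫})
    (hint : (interior Cstar).Nonempty)
    (hpointed : Cstar ∩ (-Cstar) = {0})
    (C : Set (EuclideanSpace ℝ (Fin n)))
    (hC : C = {ξ | ∀ y ∈ Cstar, 0 ≤ ⟪ξ, y⟫})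
    (N : Set (EuclideanSpace ℝ (Fin n)))
    (hN : N = {ξ ∈ interior C |
      ⟪ξ, EuclideanSpace.single (⟨0, by omega⟩ : Fin n) (1 : ℝ)⟫ = (n : ℝ)}) :
    ∃! ξstar : EuclideanSpace ℝ (Fin n), ξstar ∈ N ∧
      ∀ ξ ∈ N, ξ ≠ ξstar →
        volume {y ∈ Cstar | ⟪ξstar, y⟫ ≤ 1 / 2}
          < volume {y ∈ Cstar | ⟪ξ, y⟫ ≤ 1 / 2} := by
  set e : EuclideanSpace ℝ (Fin n) :=
    EuclideanSpace.single (⟨0, by omega⟩ : Fin n) (1 : ℝ) with he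
  have hn0 : (0:ℝ) < n := by exact_mod_cast (by omega : 0 < n)
  have hd0 : (0:ℝ) < d := by exact_mod_cast (by omega : 0 < d)
  have hve : ∀ a, ⟪v a, e⟫ = 1 := by
    intro a
    rw [he, EuclideanSpace.inner_single_right]
    simp [hv a]
  -- basic properties of the cone
  have hDcl : IsClosed Cstar := by
    have : Cstar = ⋂ a : Fin d, {y | 0 ≤ ⟪y, v a⟫} := by
      rw [hCstar]; ext y; simp
    rw [this]
    exact isClosed_iInter fun a => isClosed_le continuous_const (by fun_prop)
  have hDm := hDcl.measurableSet
  have hs : ∀ r : ℝ, 0 < r → ∀ y ∈ Cstar, r • y ∈ Cstar := by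
    intro r hr y hy
    rw [hCstar] at hy ⊢
    intro a
    rw [real_inner_smul_left]
    exact mul_nonneg hr.le (hy a)
  have ha : ∀ x ∈ Cstar, ∀ y ∈ Cstar, x + y ∈ Cstar := by
    intro x hx y hy
    rw [hCstar] at hx hy ⊢
    intro a
    rw [inner_add_left]
    exact add_nonneg (hx a) (hy a)
  have hneg : ∀ y ∈ Cstar, y ≠ 0 → -y ∉ Cstar := by
    intro y hy h0 h
    have : y ∈ Cstar ∩ (-Cstar) := ⟨hy, h⟩
    rw [hpointed] at this
    exact h0 this
  -- open part of the cone
  have hUopen : IsOpen {y : EuclideanSpace ℝ (Fin n) | ∀ a : Fin d, 0 < ⟪y, v a⟫} := by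
    have : {y : EuclideanSpace ℝ (Fin n) | ∀ a : Fin d, 0 < ⟪y, v a⟫}
        = ⋂ a : Fin d, {y | 0 < ⟪y, v a⟫} := by
      ext y; simp
    rw [this]
    exact isOpen_iInter_of_finite fun a => isOpen_lt continuous_const (by fun_prop)
  have hUsub : {y : EuclideanSpace ℝ (Fin n) | ∀ a : Fin d, 0 < ⟪y, v a⟫} ⊆ Cstar := by
    intro y hy
    rw [hCstar]
    exact fun a => (hy a).le
  have heU : e ∈ {y : EuclideanSpace ℝ (Fin n) | ∀ a : Fin d, 0 < ⟪y, v a⟫} := by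
    intro a
    rw [real_inner_comm, hve a]
    exact one_pos
  have heint : e ∈ interior Cstar := interior_maximal hUsub hUopen heU
  have hvol0 : volume Cstar ≠ 0 := (Measure.measure_pos_of_nonempty_interior _ hint).ne'
  have hpos : ∀ ξ : EuclideanSpace ℝ (Fin n), ⟪ξ, e⟫ = n →
      volume {y ∈ Cstar | ⟪ξ, y⟫ ≤ 1 / 2} ≠ 0 := by
    intro ξ hξ
    have hV : IsOpen ({y : EuclideanSpace ℝ (Fin n) | ∀ a : Fin d, 0 < ⟪y, v a⟫} ∩
        {y | ⟪ξ, y⟫ < 1 / 2}) := hUopen.inter (isOpen_lt (by fun_prop) continuous_const)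
    have hVne : ((1 / (4 * (n:ℝ))) • e) ∈
        ({y : EuclideanSpace ℝ (Fin n) | ∀ a : Fin d, 0 < ⟪y, v a⟫} ∩
        {y | ⟪ξ, y⟫ < 1 / 2}) := by
      constructor
      · intro a
        rw [real_inner_smul_left]
        exact mul_pos (by positivity) (heU a)
      · change ⟪ξ, (1 / (4 * (n:ℝ))) • e⟫ < 1 / 2
        rw [inner_smul_right, hξ]
        have : 1 / (4 * (n:ℝ)) * n = 1 / 4 := by field_simp
        rw [this]; norm_num
    have h1 := hV.measure_pos volume ⟨_, hVne⟩
    refine (h1.trans_le (measure_mono ?_)).ne'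
    rintro y ⟨h1, h2⟩
    exact ⟨hUsub h1, le_of_lt h2⟩
  have hNmem : ∀ ξ, ξ ∈ N ↔ ξ ∈ interior C ∧ ⟪ξ, e⟫ = n := by
    intro ξ; rw [hN]; rfl
  have hCmem : ∀ ξ, ξ ∈ C ↔ ∀ y ∈ Cstar, 0 ≤ ⟪ξ, y⟫ := by
    intro ξ; rw [hC]; rfl
  have hlap : ∀ ξ ∈ C, lap Cstar ξ = lapConst n * volume {y ∈ Cstar | ⟪ξ, y⟫ ≤ 1 / 2} :=
    fun ξ hξ => lap_eq hDm hs ξ ((hCmem ξ).1 hξ)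
  have hNC : ∀ ξ ∈ N, ξ ∈ C := fun ξ hξ => interior_subset ((hNmem ξ).1 hξ).1
  -- finiteness on N
  have hfin : ∀ ξ ∈ N, lap Cstar ξ ≠ ⊤ := by
    intro ξ hξ
    rw [hlap ξ (hNC ξ hξ)]
    refine ENNReal.mul_ne_top (lapConst_ne_top n) ?_
    obtain ⟨ε, hε, hb⟩ := inner_ge_of_interior ((hNmem ξ).1 hξ).1
    refine ((measure_mono ?_).trans_lt
      (measure_closedBall_lt_top (μ := volume) (x := (0 : EuclideanSpace ℝ (Fin n)))
        (r := 1 / 2 / ε))).ne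
    rintro y ⟨hy, hy2⟩
    have h1 := hb y fun η hη => by
      rw [real_inner_comm]; exact (hCmem η).1 hη y hy
    rw [mem_closedBall_zero_iff, le_div_iff₀ hε]
    rw [real_inner_comm] at h1
    linarith
  have hdualint : ∀ ξ : EuclideanSpace ℝ (Fin n),
      (∀ y ∈ Cstar, y ≠ 0 → 0 < ⟪ξ, y⟫) → ξ ∈ interior C := by
    intro ξ hξ
    rw [hC]
    exact mem_interior_dual hDcl hs hξ
  -- N is nonempty
  have hNne : ((n:ℝ) / d) • ∑ a, v a ∈ N := by
    rw [hNmem]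
    constructor
    · refine hdualint _ fun y hy h0 => ?_
      have hy' := hy
      rw [hCstar] at hy'
      rw [real_inner_smul_left, sum_inner]
      refine mul_pos (by positivity) ?_
      have h1 : ∀ a ∈ Finset.univ, 0 ≤ ⟪v a, y⟫ := fun a _ => by
        rw [real_inner_comm]; exact hy' a
      refine lt_of_le_of_ne (Finset.sum_nonneg h1) fun h => ?_
      have h2 := (Finset.sum_eq_zero_iff_of_nonneg h1).1 h.symm
      refine hneg y hy h0 ?_
      rw [hCstar]
      intro a
      rw [inner_neg_left, real_inner_comm, h2 a (Finset.mem_univ a), neg_zero]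
    · rw [real_inner_smul_left, sum_inner]
      simp only [hve]
      simp
      field_simp
  -- the compact slice
  let K : Set (EuclideanSpace ℝ (Fin n)) := {ξ | (∀ y ∈ Cstar, 0 ≤ ⟪ξ, y⟫) ∧ ⟪ξ, e⟫ = n}
  have hNK : N ⊆ K := fun ξ hξ => ⟨(hCmem ξ).1 (hNC ξ hξ), ((hNmem ξ).1 hξ).2⟩
  have hK : IsCompact K := by
    refine Metric.isCompact_of_isClosed_isBounded ?_ ?_
    · have : K = (⋂ y ∈ Cstar, {ξ | 0 ≤ ⟪ξ, y⟫}) ∩ {ξ | ⟪ξ, e⟫ = n} := by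
        ext ξ; simp [K]
      rw [this]
      exact (isClosed_biInter fun y _ => isClosed_le continuous_const (by fun_prop)).inter
        (isClosed_eq (by fun_prop) continuous_const)
    · obtain ⟨ε, hε, hb⟩ := inner_ge_of_interior heint
      refine (Metric.isBounded_closedBall
        (x := (0 : EuclideanSpace ℝ (Fin n))) (r := n / ε)).subset ?_
      rintro ξ ⟨h1, h2⟩
      rw [mem_closedBall_zero_iff, le_div_iff₀ hε]
      have := hb ξ h1
      linarith
  obtain ⟨ξs, hξs, hmin⟩ := LowerSemicontinuousOn.exists_isMinOn ⟨_, hNK hNne⟩ hK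
    ((lap_lsc Cstar).lowerSemicontinuousOn K)
  have hmin' : ∀ ξ ∈ N, lap Cstar ξs ≤ lap Cstar ξ := fun ξ hξ => hmin (hNK hξ)
  have hfs : lap Cstar ξs ≠ ⊤ := ((hmin' _ hNne).trans_lt (hfin _ hNne).lt_top).ne
  have hξsC : ξs ∈ C := (hCmem _).2 hξs.1
  have hξsN : ξs ∈ N := by
    rw [hNmem]
    refine ⟨hdualint _ fun y hy h0 => ?_, hξs.2⟩
    refine lt_of_le_of_ne (hξs.1 y hy) fun h => hfs ?_
    rw [hlap _ hξsC, vol_top hDcl hs ha hy (hneg y hy h0) h.symm (hpos _ hξs.2)]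
    exact ENNReal.mul_top (lapConst_ne_zero n)
  have hCconv : Convex ℝ C := by
    rw [hC]
    intro ξ hξ η hη a b ha hb _ y hy
    rw [inner_add_left, real_inner_smul_left, real_inner_smul_left]
    exact add_nonneg (mul_nonneg ha (hξ y hy)) (mul_nonneg hb (hη y hy))
  have key : ∀ ξ ∈ N, ξ ≠ ξs → volume {y ∈ Cstar | ⟪ξs, y⟫ ≤ 1 / 2}
      < volume {y ∈ Cstar | ⟪ξ, y⟫ ≤ 1 / 2} := by
    intro ξ hξ hne
    have hmid : (1/2 : ℝ) • ξ + (1/2 : ℝ) • ξs ∈ N := by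
      rw [hNmem]
      refine ⟨hCconv.interior ((hNmem _).1 hξ).1 ((hNmem _).1 hξsN).1
        (by norm_num) (by norm_num) (by norm_num), ?_⟩
      rw [inner_add_left, real_inner_smul_left, real_inner_smul_left,
        ((hNmem _).1 hξ).2, hξs.2]
      ring
    have h1 := lap_strict hDm hvol0 hne (hfin _ hmid)
    have h2 : lap Cstar ξs + lap Cstar ξs < lap Cstar ξ + lap Cstar ξs :=
      (add_le_add (hmin' _ hmid) (hmin' _ hmid)).trans_lt h1
    have h3 : lap Cstar ξs < lap Cstar ξ := lt_of_add_lt_add_right h2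
    rw [hlap _ hξsC, hlap _ (hNC _ hξ)] at h3
    exact lt_of_mul_lt_mul_left' h3
  refine ⟨ξs, ⟨hξsN, key⟩, ?_⟩
  rintro η ⟨hη, hη2⟩
  by_contra hne
  exact lt_asymm (key η hη hne) (hη2 ξs hξsN (Ne.symm hne))
end

section
/- Let C* ⊆ ℝⁿ be a closed convex cone with nonempty interior satisfying C* ∩ (−C*) = {0}, and let C be its dual cone. Then the function ξ ↦ vol(Δ(ξ)) is strictly convex on the interior of C; that is, for ξ₀, ξ₁ ∈ interior(C) with ξ₀ ≠ ξ₁ and 0 < t < 1, vol(Δ((1−t)ξ₀ + tξ₁)) < (1−t)·vol(Δ(ξ₀)) + t·vol(Δ(ξ₁)). -/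
open MeasureTheory RealInnerProductSpace Pointwise

namespace ReebAux

variable {n : ℕ}

lemma coercive {K : Set (EuclideanSpace ℝ (Fin n))} {ξ : EuclideanSpace ℝ (Fin n)}
    (h : ξ ∈ interior {ξ : EuclideanSpace ℝ (Fin n) | ∀ y ∈ K, 0 ≤ ⟪ξ, y⟫}) :
    ∃ ε > 0, ∀ y ∈ K, ε * ‖y‖ ≤ ⟪ξ, y⟫ := by
  rw [mem_interior_iff_mem_nhds, Metric.mem_nhds_iff] at h
  obtain ⟨δ, hδ, hb⟩ := h
  refine ⟨δ / 2, by positivity, fun y hy => ?_⟩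
  by_cases hy0 : y = 0
  · simp [hy0]
  have hn : 0 < ‖y‖ := norm_pos_iff.mpr hy0
  have hmem : ξ - (δ / 2 / ‖y‖) • y ∈ Metric.ball ξ δ := by
    rw [Metric.mem_ball, dist_eq_norm]
    have : ‖ξ - (δ / 2 / ‖y‖) • y - ξ‖ = δ / 2 := by
      rw [sub_sub_cancel_left, norm_neg, norm_smul, Real.norm_of_nonneg (by positivity)]
      field_simp
    rw [this]; linarith
  have := hb hmem y hy
  rw [inner_sub_left, inner_smul_left, real_inner_self_eq_norm_sq] at this
  have e : (starRingEnd ℝ) (δ / 2 / ‖y‖) * ‖y‖ ^ 2 = δ / 2 * ‖y‖ := by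
    simp only [conj_trivial]; field_simp
  rw [e] at this
  linarith

lemma vol_finite {K : Set (EuclideanSpace ℝ (Fin n))} {ξ : EuclideanSpace ℝ (Fin n)}
    (h : ∃ ε > 0, ∀ y ∈ K, ε * ‖y‖ ≤ ⟪ξ, y⟫) :
    volume {y ∈ K | ⟪ξ, y⟫ ≤ 1 / 2} ≠ ⊤ := by
  obtain ⟨ε, hε, hb⟩ := h
  apply ne_of_lt
  refine lt_of_le_of_lt (measure_mono (t := Metric.closedBall 0 (1 / 2 / ε)) ?_)
    measure_closedBall_lt_top
  rintro y ⟨hy, hy2⟩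
  rw [mem_closedBall_zero_iff, le_div_iff₀ hε]
  have := hb y hy
  linarith

lemma vol_scale {K : Set (EuclideanSpace ℝ (Fin n))}
    (hcone : ∀ c : ℝ, 0 ≤ c → ∀ y ∈ K, c • y ∈ K) (ξ : EuclideanSpace ℝ (Fin n))
    {s : ℝ} (hs : 0 < s) :
    volume {y ∈ K | ⟪ξ, y⟫ ≤ s}
      = ENNReal.ofReal ((2 * s) ^ n) * volume {y ∈ K | ⟪ξ, y⟫ ≤ 1 / 2} := by
  have : {y ∈ K | ⟪ξ, y⟫ ≤ s} = (2 * s) • {y ∈ K | ⟪ξ, y⟫ ≤ 1 / 2} := by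
    ext y
    rw [Set.mem_smul_set_iff_inv_smul_mem₀ (by positivity)]
    simp only [Set.mem_ofPred_eq, inner_smul_right]
    have h2 : (2 * s)⁻¹ * ⟪ξ, y⟫ ≤ 1 / 2 ↔ ⟪ξ, y⟫ ≤ s := by
      rw [inv_mul_le_iff₀ (by positivity)]
      constructor <;> intro h <;> linarith
    rw [h2]
    refine and_congr_left fun _ => ⟨fun h => hcone _ (by positivity) _ h, fun h => ?_⟩
    have := hcone (2 * s) (by positivity) _ h
    rwa [smul_smul, mul_inv_cancel₀ (by positivity), one_smul] at this
  rw [this, Measure.addHaar_smul, finrank_euclideanSpace_fin, abs_of_nonneg (by positivity)]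

lemma exp_layer {a : ℝ} (ha : 0 ≤ a) :
    ENNReal.ofReal (Real.exp (-a))
      = ∫⁻ s in Set.Ioi (0 : ℝ), ENNReal.ofReal (Real.exp (-s)) * (Set.Ici a).indicator 1 s := by
  have h1 : ∀ s : ℝ, ENNReal.ofReal (Real.exp (-s)) * (Set.Ici a).indicator 1 s
      = (Set.Ici a).indicator (fun s => ENNReal.ofReal (Real.exp (-s))) s := by
    intro s
    by_cases hs : s ∈ Set.Ici a <;> simp [hs]
  simp_rw [h1]
  rw [setLIntegral_congr Ioi_ae_eq_Ici, setLIntegral_indicator measurableSet_Ici,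
    Set.inter_eq_left.mpr (Set.Ici_subset_Ici.mpr ha), setLIntegral_congr Ioi_ae_eq_Ici.symm,
    ← ofReal_integral_eq_lintegral_ofReal (integrableOn_exp_neg_Ioi a)
      (ae_of_all _ fun s => (Real.exp_pos _).le), integral_exp_neg_Ioi]

lemma laplace {K : Set (EuclideanSpace ℝ (Fin n))} (hK : IsClosed K)
    (hcone : ∀ c : ℝ, 0 ≤ c → ∀ y ∈ K, c • y ∈ K) (ξ : EuclideanSpace ℝ (Fin n))
    (hξ : ∀ y ∈ K, 0 ≤ ⟪ξ, y⟫) :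
    ∫⁻ y in K, ENNReal.ofReal (Real.exp (-⟪ξ, y⟫))
      = (∫⁻ s in Set.Ioi (0 : ℝ), ENNReal.ofReal (Real.exp (-s) * (2 * s) ^ n))
        * volume {y ∈ K | ⟪ξ, y⟫ ≤ 1 / 2} := by
  have hm : Measurable fun y : EuclideanSpace ℝ (Fin n) => (⟪ξ, y⟫ : ℝ) := by fun_prop
  have e1 : ∫⁻ y in K, ENNReal.ofReal (Real.exp (-⟪ξ, y⟫))
      = ∫⁻ y in K, ∫⁻ s in Set.Ioi (0 : ℝ),
          ENNReal.ofReal (Real.exp (-s)) * (Set.Ici (⟪ξ, y⟫ : ℝ)).indicator 1 s :=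
    setLIntegral_congr_fun hK.measurableSet fun y hy => exp_layer (hξ y hy)
  have hms : MeasurableSet {p : EuclideanSpace ℝ (Fin n) × ℝ | (⟪ξ, p.1⟫ : ℝ) ≤ p.2} :=
    measurableSet_le (hm.comp measurable_fst) measurable_snd
  rw [e1, lintegral_lintegral_swap, ← lintegral_mul_const _ (by fun_prop)]
  · refine setLIntegral_congr_fun measurableSet_Ioi fun s hs => ?_
    have hs' : (0 : ℝ) < s := hs
    have e2 : ∀ y : EuclideanSpace ℝ (Fin n),
        (Set.Ici (⟪ξ, y⟫ : ℝ)).indicator (1 : ℝ → ENNReal) s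
          = {y | (⟪ξ, y⟫ : ℝ) ≤ s}.indicator 1 y := by
      intro y; simp [Set.indicator_apply]
    have hms2 : MeasurableSet {y | (⟪ξ, y⟫ : ℝ) ≤ s} := measurableSet_le hm measurable_const
    simp only [e2]
    rw [lintegral_const_mul _ (measurable_one.indicator hms2), lintegral_indicator_one hms2,
      Measure.restrict_apply hms2, Set.inter_comm]
    change _ * volume {y ∈ K | ⟪ξ, y⟫ ≤ s} = _
    rw [vol_scale hcone ξ hs', ← mul_assoc, ENNReal.ofReal_mul (Real.exp_pos _).le]
  · have : (Function.uncurry fun (y : EuclideanSpace ℝ (Fin n)) (s : ℝ) =>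
        ENNReal.ofReal (Real.exp (-s)) * (Set.Ici (⟪ξ, y⟫ : ℝ)).indicator 1 s)
        = fun p => ENNReal.ofReal (Real.exp (-p.2)) *
          {p : EuclideanSpace ℝ (Fin n) × ℝ | (⟪ξ, p.1⟫ : ℝ) ≤ p.2}.indicator 1 p := by
      ext p; simp [Function.uncurry, Set.indicator_apply]
    rw [this]
    exact (Measurable.mul (by fun_prop) (measurable_one.indicator hms)).aemeasurable

lemma const_finite (n : ℕ) :
    (∫⁻ s in Set.Ioi (0 : ℝ), ENNReal.ofReal (Real.exp (-s) * (2 * s) ^ n)) ≠ ⊤ := by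
  have h := (Real.GammaIntegral_convergent (s := n + 1) (by positivity)).const_mul (2 ^ n)
  refine (Integrable.lintegral_lt_top (h.congr ?_)).ne
  refine ae_of_all _ fun s => ?_
  simp only [add_sub_cancel_right, Real.rpow_natCast]
  ring

lemma null_hyper {v : EuclideanSpace ℝ (Fin n)} (hv : v ≠ 0) :
    ∀ᵐ y : EuclideanSpace ℝ (Fin n), ⟪v, y⟫ ≠ (0 : ℝ) := by
  have := Measure.addHaar_submodule (volume : Measure (EuclideanSpace ℝ (Fin n)))
    (LinearMap.ker (innerSL ℝ v).toLinearMap) (by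
      intro h
      have : v ∈ LinearMap.ker (innerSL ℝ v).toLinearMap := h ▸ Submodule.mem_top
      simp at this
      exact hv this)
  rw [ae_iff]
  convert this using 2
  ext y
  simp

end ReebAux

open ReebAux in
/-- For a closed convex pointed cone `C*` with nonempty interior, the
function `ξ ↦ vol(Δ(ξ))`, where `Δ(ξ) = {y ∈ C* | ⟪ξ, y⟫ ≤ 1/2}`, is strictly convex on
the interior of the dual cone `C`. -/
theorem volume_of_reeb_polytope_strictly_convex
    (n : ℕ) (Cstar : Set (EuclideanSpace ℝ (Fin n)))
    (hclosed : IsClosed Cstar) (hconv : Convex ℝ Cstar)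
    (hcone : ∀ c : ℝ, 0 ≤ c → ∀ y ∈ Cstar, c • y ∈ Cstar)
    (hint : (interior Cstar).Nonempty)
    (hpointed : Cstar ∩ (-Cstar) = {0})
    (C : Set (EuclideanSpace ℝ (Fin n)))
    (hC : C = {ξ | ∀ y ∈ Cstar, 0 ≤ ⟪ξ, y⟫})
    (ξ₀ ξ₁ : EuclideanSpace ℝ (Fin n)) (t : ℝ)
    (hξ₀ : ξ₀ ∈ interior C) (hξ₁ : ξ₁ ∈ interior C)
    (hne : ξ₀ ≠ ξ₁) (ht0 : 0 < t) (ht1 : t < 1) :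
    volume {y ∈ Cstar | ⟪(1 - t) • ξ₀ + t • ξ₁, y⟫ ≤ 1 / 2}
      < ENNReal.ofReal (1 - t) * volume {y ∈ Cstar | ⟪ξ₀, y⟫ ≤ 1 / 2}
        + ENNReal.ofReal t * volume {y ∈ Cstar | ⟪ξ₁, y⟫ ≤ 1 / 2} := by
  subst hC
  have p0 := interior_subset hξ₀
  have p1 := interior_subset hξ₁
  have ht1' : 0 < 1 - t := by linarith
  have hin : ∀ y, ⟪(1 - t) • ξ₀ + t • ξ₁, y⟫ = (1 - t) * ⟪ξ₀, y⟫ + t * ⟪ξ₁, y⟫ := by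
    intro y
    rw [inner_add_left, real_inner_smul_left, real_inner_smul_left]
  have hco : ∃ ε > 0, ∀ y ∈ Cstar, ε * ‖y‖ ≤ ⟪(1 - t) • ξ₀ + t • ξ₁, y⟫ := by
    obtain ⟨a, ha, hA⟩ := coercive hξ₀
    obtain ⟨b, hb, hB⟩ := coercive hξ₁
    refine ⟨(1 - t) * a + t * b, by positivity, fun y hy => ?_⟩
    rw [hin]
    have h1 := mul_le_mul_of_nonneg_left (hA y hy) ht1'.le
    have h2 := mul_le_mul_of_nonneg_left (hB y hy) ht0.le
    linarith
  have pt : ∀ y ∈ Cstar, 0 ≤ ⟪(1 - t) • ξ₀ + t • ξ₁, y⟫ := by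
    intro y hy
    rw [hin]
    have h1 := mul_nonneg ht1'.le (p0 y hy)
    have h2 := mul_nonneg ht0.le (p1 y hy)
    linarith
  have Lt := laplace hclosed hcone _ pt
  have L0 := laplace hclosed hcone _ p0
  have L1 := laplace hclosed hcone _ p1
  have key : ∫⁻ y in Cstar, ENNReal.ofReal (Real.exp (-⟪(1 - t) • ξ₀ + t • ξ₁, y⟫))
      < ∫⁻ y in Cstar, (ENNReal.ofReal (1 - t) * ENNReal.ofReal (Real.exp (-⟪ξ₀, y⟫))
        + ENNReal.ofReal t * ENNReal.ofReal (Real.exp (-⟪ξ₁, y⟫))) := by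
    refine lintegral_strict_mono ?_ (by fun_prop) ?_ ?_
    · rw [Ne, Measure.restrict_eq_zero]
      exact (Measure.measure_pos_of_nonempty_interior _ hint).ne'
    · rw [Lt]
      exact ENNReal.mul_ne_top (const_finite n) (vol_finite hco)
    · filter_upwards [ae_restrict_of_ae (null_hyper (sub_ne_zero.mpr hne))] with y hy
      have hy' : -⟪ξ₀, y⟫ ≠ -⟪ξ₁, y⟫ := by
        intro h
        apply hy
        rw [inner_sub_left]
        linarith
      have := strictConvexOn_exp.2 (Set.mem_univ _) (Set.mem_univ _) hy' ht1' ht0 (by ring)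
      simp only [smul_eq_mul] at this
      rw [← ENNReal.ofReal_mul ht1'.le, ← ENNReal.ofReal_mul ht0.le,
        ← ENNReal.ofReal_add (by positivity) (by positivity),
        ENNReal.ofReal_lt_ofReal_iff (by positivity), hin]
      rwa [neg_add, ← mul_neg, ← mul_neg]
  rw [lintegral_add_left (by fun_prop), lintegral_const_mul _ (by fun_prop),
    lintegral_const_mul _ (by fun_prop), Lt, L0, L1, mul_left_comm, mul_left_comm (ENNReal.ofReal t),
    ← mul_add] at key
  exact lt_of_mul_lt_mul_left' key
end

section
/- Let C* ⊆ ℝⁿ be a closed convex cone with nonempty interior satisfying C* ∩ (−C*) = {0}, and let C be its dual cone. Then the function f(ξ) = vol(Δ(ξ)) is (Fréchet) differentiable at every ξ in the interior of C, and it satisfies the Euler relation Df(ξ)(ξ) = −n·f(ξ). -/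
open MeasureTheory RealInnerProductSpace Pointwise

lemma vf_scale (n : ℕ) (K : Set (EuclideanSpace ℝ (Fin n)))
    (hcone : ∀ c : ℝ, 0 ≤ c → ∀ y ∈ K, c • y ∈ K)
    (ξ : EuclideanSpace ℝ (Fin n)) (t : ℝ) (ht : 0 < t) :
    volume {y ∈ K | ⟪ξ, y⟫ ≤ t} =
      ENNReal.ofReal ((2 * t) ^ n) * volume {y ∈ K | ⟪ξ, y⟫ ≤ 1 / 2} := by
  have h : {y ∈ K | ⟪ξ, y⟫ ≤ t} = (2 * t) • {y ∈ K | ⟪ξ, y⟫ ≤ 1 / 2} := by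
    ext y
    rw [Set.mem_smul_set_iff_inv_smul_mem₀ (by positivity)]
    simp only [Set.mem_ofPred_eq, inner_smul_right]
    have h1 : (2 * t)⁻¹ * ⟪ξ, y⟫ ≤ 1 / 2 ↔ ⟪ξ, y⟫ ≤ t := by
      rw [inv_mul_le_iff₀ (by positivity)]
      constructor <;> intro h <;> linarith
    rw [h1]
    refine and_congr_left fun _ => ⟨fun hy => hcone _ (by positivity) _ hy, fun hy => ?_⟩
    have := hcone (2 * t) (by positivity) _ hy
    rwa [smul_inv_smul₀ (by positivity)] at this
  rw [h, Measure.addHaar_smul]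
  simp only [finrank_euclideanSpace, Fintype.card_fin]
  rw [abs_of_nonneg (by positivity)]

lemma vf_laplace (n : ℕ) (K : Set (EuclideanSpace ℝ (Fin n))) (hclosed : IsClosed K)
    (hcone : ∀ c : ℝ, 0 ≤ c → ∀ y ∈ K, c • y ∈ K)
    (ξ : EuclideanSpace ℝ (Fin n)) (hξ : ∀ y ∈ K, 0 ≤ ⟪ξ, y⟫) :
    ∫ y in K, Real.exp (-⟪ξ, y⟫) =
      (∫⁻ t in Set.Ioi (0:ℝ), ENNReal.ofReal (Real.exp (-t) * (2 * t) ^ n)).toReal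
        * (volume {y ∈ K | ⟪ξ, y⟫ ≤ 1 / 2}).toReal := by
  have hK := hclosed.measurableSet
  rw [integral_eq_lintegral_of_nonneg_ae (Filter.Eventually.of_forall fun y => (Real.exp_pos _).le)
    (by fun_prop), ← ENNReal.toReal_mul]
  congr 1
  let F : EuclideanSpace ℝ (Fin n) → ℝ → ENNReal := fun y t =>
    {p : EuclideanSpace ℝ (Fin n) × ℝ | ⟪ξ, p.1⟫ ≤ p.2}.indicator
      (fun p => ENNReal.ofReal (Real.exp (-p.2))) (y, t)
  have hF : Measurable (Function.uncurry F) := by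
    refine Measurable.indicator (by fun_prop) ?_
    exact measurableSet_le (by fun_prop) (by fun_prop)
  have h1 : ∀ y ∈ K, ENNReal.ofReal (Real.exp (-⟪ξ, y⟫)) = ∫⁻ t in Set.Ioi (0:ℝ), F y t := by
    intro y hy
    have e : ∀ t, F y t = (Set.Ici ⟪ξ, y⟫).indicator (fun t => ENNReal.ofReal (Real.exp (-t))) t := by
      intro t
      simp only [F, Set.indicator, Set.mem_ofPred_eq, Set.mem_Ici]
    rw [setLIntegral_congr (Ioi_ae_eq_Ici (a := (0:ℝ)))]
    simp_rw [e]
    rw [setLIntegral_indicator measurableSet_Ici, Set.inter_eq_left.2 (Set.Ici_subset_Ici.2 (hξ y hy)),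
      setLIntegral_congr (Ioi_ae_eq_Ici (a := ⟪ξ, y⟫)).symm, ← integral_exp_neg_Ioi,
      ofReal_integral_eq_lintegral_ofReal (integrableOn_exp_neg_Ioi _)
      (Filter.Eventually.of_forall fun y => (Real.exp_pos _).le)]
  rw [setLIntegral_congr_fun hK h1, lintegral_lintegral_swap hF.aemeasurable,
    ← lintegral_mul_const _ (by fun_prop)]
  refine setLIntegral_congr_fun measurableSet_Ioi fun t ht => ?_
  have e : ∀ y, F y t = {y | ⟪ξ, y⟫ ≤ t}.indicator (fun y => ENNReal.ofReal (Real.exp (-t))) y := by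
    intro y
    simp only [F, Set.indicator, Set.mem_ofPred_eq]
  have hm : MeasurableSet {y : EuclideanSpace ℝ (Fin n) | ⟪ξ, y⟫ ≤ t} :=
    measurableSet_le (by fun_prop) (by fun_prop)
  simp_rw [e]
  rw [setLIntegral_indicator hm, setLIntegral_const, ENNReal.ofReal_mul (Real.exp_pos _).le, mul_assoc,
    ← vf_scale n K hcone ξ t ht]
  congr 2
  ext y
  simp [and_comm]

lemma vf_const (n : ℕ) :
    (∫⁻ t in Set.Ioi (0:ℝ), ENNReal.ofReal (Real.exp (-t) * (2 * t) ^ n)).toReal ≠ 0 := by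
  have e : ∫ t in Set.Ioi (0:ℝ), Real.exp (-t) * (2 * t) ^ n = 2 ^ n * Real.Gamma (n + 1) := by
    rw [Real.Gamma_eq_integral (by positivity), ← integral_const_mul]
    refine setIntegral_congr_fun measurableSet_Ioi fun t ht => ?_
    simp only [add_sub_cancel_right, Real.rpow_natCast, mul_pow]
    ring
  rw [integral_eq_lintegral_of_nonneg_ae ?_ (by fun_prop)] at e
  · rw [e]
    have := Real.Gamma_pos_of_pos (s := (n:ℝ) + 1) (by positivity)
    positivity
  · refine (ae_restrict_iff' measurableSet_Ioi).2 (Filter.Eventually.of_forall fun t ht => ?_)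
    have : (0:ℝ) < t := ht
    simp only [Pi.zero_apply]
    positivity

lemma vf_integrable (n : ℕ) (ε : ℝ) (hε : 0 < ε) :
    Integrable (fun y : EuclideanSpace ℝ (Fin n) => (1 + ‖y‖) * Real.exp (-(ε * ‖y‖))) := by
  have h := integrable_one_add_norm (E := EuclideanSpace ℝ (Fin n)) (μ := volume)
    (r := (n + 1 : ℕ)) (by simp)
  refine (h.const_mul ((n + 2).factorial * Real.exp ε / ε ^ (n + 2))).mono' (by fun_prop)
    (Filter.Eventually.of_forall fun y => ?_)
  have hy : 0 < 1 + ‖y‖ := by positivity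
  rw [Real.norm_of_nonneg (by positivity), Real.rpow_neg hy.le, Real.rpow_natCast, Real.exp_neg]
  have key := Real.pow_div_factorial_le_exp (ε * (1 + ‖y‖)) (by positivity) (n + 2)
  rw [mul_add, mul_one, Real.exp_add, div_le_iff₀ (by positivity)] at key
  have k2 : (ε * (1 + ‖y‖)) ^ (n + 2) ≤ Real.exp ε * Real.exp (ε * ‖y‖) * (n + 2).factorial := by
    rw [mul_add, mul_one]; exact key
  rw [mul_pow, pow_succ (1 + ‖y‖)] at k2
  rw [← div_eq_mul_inv, ← div_eq_mul_inv, div_div, div_le_div_iff₀ (by positivity) (by positivity)]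
  nlinarith [k2]

lemma vf_diff (n : ℕ) (K : Set (EuclideanSpace ℝ (Fin n))) (hclosed : IsClosed K)
    (ξ : EuclideanSpace ℝ (Fin n)) (ε : ℝ) (hε : 0 < ε)
    (hξ : ∀ ξ' ∈ Metric.ball ξ ε, ∀ y ∈ K, ε * ‖y‖ ≤ ⟪ξ', y⟫) :
    DifferentiableAt ℝ (fun ξ => ∫ y in K, Real.exp (-⟪ξ, y⟫)) ξ := by
  have hK := hclosed.measurableSet
  have hi := (vf_integrable n ε hε).integrableOn (s := K)
  refine (hasFDerivAt_integral_of_dominated_of_fderiv_le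
    (F' := fun x y => Real.exp (-⟪x, y⟫) • -(innerSL ℝ y))
    (bound := fun y : EuclideanSpace ℝ (Fin n) => (1 + ‖y‖) * Real.exp (-(ε * ‖y‖)))
    (s := Metric.ball ξ ε) (Metric.ball_mem_nhds ξ hε) ?_ ?_ ?_ ?_ hi ?_).differentiableAt
  · exact Filter.Eventually.of_forall fun x => by fun_prop
  · refine hi.mono' (by fun_prop) ((ae_restrict_iff' hK).2 (Filter.Eventually.of_forall fun y hy => ?_))
    have := hξ ξ (Metric.mem_ball_self hε) y hy
    rw [Real.norm_of_nonneg (Real.exp_pos _).le]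
    calc Real.exp (-⟪ξ, y⟫) ≤ 1 * Real.exp (-(ε * ‖y‖)) := by
          rw [one_mul]; gcongr
      _ ≤ _ := by gcongr; linarith [norm_nonneg y]
  · exact Continuous.aestronglyMeasurable (by fun_prop)
  · refine (ae_restrict_iff' hK).2 (Filter.Eventually.of_forall fun y hy x hx => ?_)
    have := hξ x hx y hy
    rw [norm_smul, norm_neg, innerSL_apply_norm, Real.norm_of_nonneg (Real.exp_pos _).le, mul_comm]
    gcongr
    linarith
  · refine Filter.Eventually.of_forall fun y x hx => ?_
    have h1 : HasFDerivAt (fun x : EuclideanSpace ℝ (Fin n) => -⟪x, y⟫) (-(innerSL ℝ y)) x := by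
      have := (innerSL ℝ y).hasFDerivAt (x := x)
      have h2 := this.neg
      refine h2.congr_of_eventuallyEq (Filter.Eventually.of_forall fun z => ?_)
      simp [real_inner_comm]
    exact h1.exp

/-- For a closed convex pointed cone `C*` with nonempty interior, the
volume function `f(ξ) = vol(Δ(ξ))` is Fréchet differentiable on the interior of the dual
cone `C`, and satisfies the Euler relation `Df(ξ)(ξ) = −n·f(ξ)`. -/
theorem volume_function_differentiable_and_euler
    (n : ℕ) (Cstar : Set (EuclideanSpace ℝ (Fin n)))
    (hclosed : IsClosed Cstar) (hconv : Convex ℝ Cstar)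
    (hcone : ∀ c : ℝ, 0 ≤ c → ∀ y ∈ Cstar, c • y ∈ Cstar)
    (hint : (interior Cstar).Nonempty)
    (hpointed : Cstar ∩ (-Cstar) = {0})
    (C : Set (EuclideanSpace ℝ (Fin n)))
    (hC : C = {ξ | ∀ y ∈ Cstar, 0 ≤ ⟪ξ, y⟫})
    (f : EuclideanSpace ℝ (Fin n) → ℝ)
    (hf : f = fun ξ => (volume {y ∈ Cstar | ⟪ξ, y⟫ ≤ 1 / 2}).toReal)
    (ξ : EuclideanSpace ℝ (Fin n)) (hξ : ξ ∈ interior C) :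
    DifferentiableAt ℝ f ξ ∧ fderiv ℝ f ξ ξ = -(n : ℝ) * f ξ := by
  have hd : DifferentiableAt ℝ f ξ := by
    obtain ⟨r, hr, hb⟩ := Metric.mem_nhds_iff.1 (mem_interior_iff_mem_nhds.1 hξ)
    have hbd : ∀ ξ' ∈ Metric.ball ξ (r / 2), ∀ y ∈ Cstar, r / 2 * ‖y‖ ≤ ⟪ξ', y⟫ := by
      intro ξ' hξ' y hy
      by_cases h0 : y = 0
      · simp [h0]
      have hn : 0 < ‖y‖ := norm_pos_iff.2 h0
      have hm : ξ' - (r / 2 / ‖y‖) • y ∈ C := by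
        apply hb
        rw [Metric.mem_ball, dist_eq_norm] at *
        have e : ‖(r / 2 / ‖y‖) • y‖ = r / 2 := by
          rw [norm_smul, Real.norm_of_nonneg (by positivity)]
          field_simp
        calc ‖ξ' - (r / 2 / ‖y‖) • y - ξ‖ = ‖(ξ' - ξ) - (r / 2 / ‖y‖) • y‖ := by congr 1; abel
          _ ≤ ‖ξ' - ξ‖ + ‖(r / 2 / ‖y‖) • y‖ := norm_sub_le _ _
          _ < r := by linarith
      rw [hC] at hm
      have := hm y hy
      rw [inner_sub_left, real_inner_smul_left, real_inner_self_eq_norm_sq] at this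
      have e : r / 2 / ‖y‖ * ‖y‖ ^ 2 = r / 2 * ‖y‖ := by field_simp
      linarith
    have hg := vf_diff n Cstar hclosed ξ (r / 2) (by positivity) hbd
    refine (hg.const_mul (∫⁻ t in Set.Ioi (0:ℝ),
      ENNReal.ofReal (Real.exp (-t) * (2 * t) ^ n)).toReal⁻¹).congr_of_eventuallyEq ?_
    filter_upwards [mem_interior_iff_mem_nhds.1 hξ] with x hx
    rw [hC] at hx
    rw [vf_laplace n Cstar hclosed hcone x hx, inv_mul_cancel_left₀ (vf_const n), hf]
  refine ⟨hd, ?_⟩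
  have hhom : ∀ c : ℝ, 0 < c → f (c • ξ) = (c⁻¹) ^ n * f ξ := by
    intro c hc
    have e : {y ∈ Cstar | ⟪c • ξ, y⟫ ≤ 1 / 2} = {y ∈ Cstar | ⟪ξ, y⟫ ≤ c⁻¹ / 2} := by
      ext y
      simp only [Set.mem_ofPred_eq, real_inner_smul_left]
      refine and_congr_right fun _ => ?_
      rw [← le_inv_mul_iff₀ hc]
      ring_nf
    simp only [hf]
    rw [e, vf_scale n Cstar hcone ξ _ (by positivity), ENNReal.toReal_mul,
      ENNReal.toReal_ofReal (by positivity)]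
    congr 2
    ring
  have h1 : HasDerivAt (fun c : ℝ => f (c • ξ)) (fderiv ℝ f ξ ξ) 1 := by
    have hl : HasDerivAt (fun c : ℝ => c • ξ) ξ 1 := by
      simpa using (hasDerivAt_id (1:ℝ)).smul_const ξ
    have hd' : HasFDerivAt f (fderiv ℝ f ξ) ((1:ℝ) • ξ) := by
      rw [one_smul]; exact hd.hasFDerivAt
    exact hd'.comp_hasDerivAt (1:ℝ) hl
  have h2 : HasDerivAt (fun c : ℝ => f (c • ξ)) (-(n:ℝ) * f ξ) 1 := by
    have := (((hasDerivAt_inv (one_ne_zero (α := ℝ))).pow n).mul_const (f ξ))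
    refine HasDerivAt.congr_of_eventuallyEq (f := fun c : ℝ => (c⁻¹) ^ n * f ξ) ?_ ?_
    · have e : (n:ℝ) * ((1:ℝ)⁻¹) ^ (n - 1) * (-((1:ℝ) ^ 2)⁻¹) * f ξ = -(n:ℝ) * f ξ := by simp
      rw [← e]
      exact this
    · filter_upwards [lt_mem_nhds (zero_lt_one (α := ℝ))] with c hc using hhom c hc
  exact h1.unique h2
end

section
/- Let C* ⊆ ℝⁿ be a closed convex cone with nonempty interior, and let C be its dual cone. If ξ₀ ∈ C with ξ₀ ≠ 0 and ξ₀ ∉ interior(C) (i.e. ξ₀ lies on the boundary of the dual cone), then the set {y ∈ C* : ⟨ξ₀, y⟩ ≤ 1/2} has infinite Lebesgue measure. -/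
open MeasureTheory RealInnerProductSpace Pointwise

/-- For a closed convex cone `C*` with nonempty interior and a nonzero
`ξ₀` lying on the boundary of the dual cone `C` (i.e. `ξ₀ ∈ C` but `ξ₀ ∉ interior C`),
the set `Δ(ξ₀) = {y ∈ C* | ⟪ξ₀, y⟫ ≤ 1/2}` has infinite Lebesgue measure. -/
theorem volume_infinite_on_boundary_of_dual_cone
    (n : ℕ) (Cstar : Set (EuclideanSpace ℝ (Fin n)))
    (hclosed : IsClosed Cstar) (hconv : Convex ℝ Cstar)
    (hcone : ∀ c : ℝ, 0 ≤ c → ∀ y ∈ Cstar, c • y ∈ Cstar)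
    (hint : (interior Cstar).Nonempty)
    (C : Set (EuclideanSpace ℝ (Fin n)))
    (hC : C = {ξ | ∀ y ∈ Cstar, 0 ≤ ⟪ξ, y⟫})
    (ξ₀ : EuclideanSpace ℝ (Fin n)) (hξ₀C : ξ₀ ∈ C)
    (hξ₀ne : ξ₀ ≠ 0) (hξ₀bd : ξ₀ ∉ interior C) :
    volume {y ∈ Cstar | ⟪ξ₀, y⟫ ≤ 1 / 2} = ⊤ := by
  subst hC
  have hadd : ∀ x ∈ Cstar, ∀ y ∈ Cstar, x + y ∈ Cstar := by
    intro x hx y hy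
    have h := hcone 2 (by norm_num) _
      (hconv hx hy (by norm_num : (0:ℝ) ≤ 1/2) (by norm_num : (0:ℝ) ≤ 1/2) (by norm_num))
    rw [smul_add, smul_smul, smul_smul] at h
    norm_num at h
    exact h
  -- a nonzero vector of the cone orthogonal to `ξ₀`
  have hy0 : ∃ y ∈ Cstar, y ≠ 0 ∧ ⟪ξ₀, y⟫ = 0 := by
    by_contra! hno
    apply hξ₀bd
    have hK : IsCompact (Cstar ∩ Metric.sphere 0 1) :=
      (isCompact_sphere (0 : EuclideanSpace ℝ (Fin n)) 1).inter_left hclosed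
    have hδ : ∃ δ > 0, ∀ y ∈ Cstar ∩ Metric.sphere 0 1, δ ≤ ⟪ξ₀, y⟫ := by
      rcases (Cstar ∩ Metric.sphere 0 1).eq_empty_or_nonempty with he | hne
      · exact ⟨1, one_pos, by simp [he]⟩
      · obtain ⟨z, hz, hmin⟩ := hK.exists_isMinOn hne
          (f := fun y => ⟪ξ₀, y⟫) (by fun_prop)
        refine ⟨⟪ξ₀, z⟫, ?_, fun y hy => hmin hy⟩
        have hz0 : z ≠ 0 := by
          rintro rfl
          simpa using hz.2
        exact lt_of_le_of_ne (hξ₀C z hz.1) (Ne.symm (hno z hz.1 hz0))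
    obtain ⟨δ, hδ0, hδ⟩ := hδ
    rw [mem_interior_iff_mem_nhds, Metric.mem_nhds_iff]
    refine ⟨δ, hδ0, fun ξ hξ y hy => ?_⟩
    by_cases hy0 : y = 0
    · simp [hy0]
    have hny : 0 < ‖y‖ := norm_pos_iff.mpr hy0
    have h1 := hδ (‖y‖⁻¹ • y) ⟨hcone _ (by positivity) y hy, by simp [norm_smul, hny.ne']⟩
    rw [real_inner_smul_right, inv_mul_eq_div, le_div_iff₀ hny] at h1
    have h2 : |⟪ξ - ξ₀, y⟫| ≤ ‖ξ - ξ₀‖ * ‖y‖ := abs_real_inner_le_norm _ _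
    have h3 : ‖ξ - ξ₀‖ < δ := by rwa [Metric.mem_ball, dist_eq_norm] at hξ
    have h4 : ‖ξ - ξ₀‖ * ‖y‖ ≤ δ * ‖y‖ := by gcongr
    rw [inner_sub_left] at h2
    have h5 := (abs_le.mp h2).1
    linarith
  obtain ⟨y₀, hy₀, hy₀ne, hy₀z⟩ := hy0
  -- an open ball in the set
  have hball : ∃ q : EuclideanSpace ℝ (Fin n), ∃ r > 0,
      Metric.ball q r ⊆ {y ∈ Cstar | ⟪ξ₀, y⟫ ≤ 1 / 2} := by
    obtain ⟨p, hp⟩ := hint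
    have ha : 0 ≤ ⟪ξ₀, p⟫ := hξ₀C p (interior_subset hp)
    set c : ℝ := 1 / (4 * (⟪ξ₀, p⟫ + 1)) with hc
    have hc0 : 0 < c := by positivity
    have hcp : c • p ∈ interior Cstar := by
      have hsub : c • Cstar ⊆ Cstar := by
        rintro _ ⟨y, hy, rfl⟩
        exact hcone c hc0.le y hy
      apply interior_mono hsub
      rw [interior_smul₀ hc0.ne']
      exact Set.smul_mem_smul_set hp
    have hlt : ⟪ξ₀, c • p⟫ < 1 / 2 := by
      rw [real_inner_smul_right, hc, one_div, inv_mul_eq_div, div_lt_iff₀ (by positivity)]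
      linarith
    have hopen : IsOpen (interior Cstar ∩ {y | ⟪ξ₀, y⟫ < 1 / 2}) :=
      isOpen_interior.inter (isOpen_lt (by fun_prop) continuous_const)
    obtain ⟨r, hr, hsub⟩ := Metric.isOpen_iff.mp hopen (c • p) ⟨hcp, hlt⟩
    exact ⟨c • p, r, hr, fun y hy => ⟨interior_subset (hsub hy).1, (hsub hy).2.le⟩⟩
  obtain ⟨q, r, hr, hsub⟩ := hball
  have hny : 0 < ‖y₀‖ := norm_pos_iff.mpr hy₀ne
  set T : ℝ := 2 * r / ‖y₀‖ with hT
  have hT0 : 0 < T := by positivity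
  have hTn : T * ‖y₀‖ = 2 * r := by rw [hT]; field_simp
  let B : ℕ → Set (EuclideanSpace ℝ (Fin n)) := fun k => Metric.ball (q + ((k : ℝ) * T) • y₀) r
  have hBsub : (⋃ k, B k) ⊆ {y ∈ Cstar | ⟪ξ₀, y⟫ ≤ 1 / 2} := by
    refine Set.iUnion_subset fun k y hy => ?_
    have hz : y - ((k : ℝ) * T) • y₀ ∈ Metric.ball q r := by
      have hy' : dist y (q + ((k : ℝ) * T) • y₀) < r := hy
      rw [Metric.mem_ball, dist_eq_norm]
      rw [dist_eq_norm] at hy'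
      convert hy' using 2
      abel
    obtain ⟨h1, h2⟩ := hsub hz
    refine ⟨?_, ?_⟩
    · have := hadd _ h1 _ (hcone ((k : ℝ) * T) (by positivity) y₀ hy₀)
      simpa using this
    · rw [inner_sub_right, real_inner_smul_right, hy₀z] at h2
      simpa using h2
  have hdisj : Pairwise (Function.onFun Disjoint B) := by
    intro k l hkl
    apply Metric.ball_disjoint_ball
    rw [dist_eq_norm, add_sub_add_left_eq_sub, ← sub_smul, ← sub_mul, norm_smul, norm_mul,
      Real.norm_of_nonneg hT0.le, mul_assoc, hTn]
    have h1 : (1 : ℝ) ≤ ‖(k : ℝ) - l‖ := by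
      rw [Real.norm_eq_abs]
      have : (1 : ℤ) ≤ |(k : ℤ) - l| := Int.one_le_abs (by omega)
      exact_mod_cast this
    nlinarith
  refine top_unique (le_trans ?_ (measure_mono hBsub))
  rw [measure_iUnion hdisj (fun k => measurableSet_ball)]
  have hconst : ∀ k, volume (B k) = volume (Metric.ball (0 : EuclideanSpace ℝ (Fin n)) r) :=
    fun k => Measure.addHaar_ball_center _ _ _
  simp_rw [hconst]
  rw [ENNReal.tsum_const_eq_top_of_ne_zero (Metric.measure_ball_pos _ _ hr).ne']
end

section
/- Let C* ⊆ ℝⁿ be a closed convex cone with nonempty interior, let C be its dual cone, and let ξ_k be a sequence in the interior of C converging to a point ξ₀ ∈ C with ξ₀ ≠ 0 and ξ₀ ∉ interior(C). Then vol(Δ(ξ_k)) → ∞ as k → ∞, where Δ(ξ) = {y ∈ C* : ⟨ξ, y⟩ ≤ 1/2}. -/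
open MeasureTheory RealInnerProductSpace Pointwise Filter

/-- For a closed convex cone `C*` with nonempty interior, if a sequence
`ξ_k` of points of the interior of the dual cone `C` converges to a nonzero boundary point
`ξ₀` of `C`, then `vol(Δ(ξ_k)) → ∞`, where `Δ(ξ) = {y ∈ C* | ⟪ξ, y⟫ ≤ 1/2}`. -/
theorem volume_tendsto_top_at_boundary_of_dual_cone
    (n : ℕ) (Cstar : Set (EuclideanSpace ℝ (Fin n)))
    (hclosed : IsClosed Cstar) (hconv : Convex ℝ Cstar)
    (hcone : ∀ c : ℝ, 0 ≤ c → ∀ y ∈ Cstar, c • y ∈ Cstar)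
    (hint : (interior Cstar).Nonempty)
    (C : Set (EuclideanSpace ℝ (Fin n)))
    (hC : C = {ξ | ∀ y ∈ Cstar, 0 ≤ ⟪ξ, y⟫})
    (ξ : ℕ → EuclideanSpace ℝ (Fin n))
    (hmem : ∀ k : ℕ, ξ k ∈ interior C)
    (ξ₀ : EuclideanSpace ℝ (Fin n))
    (hlim : Tendsto ξ atTop (nhds ξ₀))
    (hξ₀C : ξ₀ ∈ C) (hξ₀ne : ξ₀ ≠ 0) (hξ₀bd : ξ₀ ∉ interior C) :
    Tendsto (fun k => volume {y ∈ Cstar | ⟪ξ k, y⟫ ≤ 1 / 2}) atTop (nhds ⊤) := by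
  -- a unit vector of the cone orthogonal to the limit
  have hv : ∃ v ∈ Cstar, ‖v‖ = 1 ∧ ⟪ξ₀, v⟫ = 0 := by
    by_contra hcon
    push Not at hcon
    apply hξ₀bd
    have hcomp : IsCompact (Metric.sphere (0 : EuclideanSpace ℝ (Fin n)) 1 ∩ Cstar) :=
      (isCompact_sphere _ _).inter_right hclosed
    obtain ⟨d, hd, hdle⟩ := hcomp.exists_forall_le' (f := fun y => ⟪ξ₀, y⟫) (a := 0)
      (by fun_prop) (by
        rintro y ⟨hy1, hy2⟩
        rw [hC] at hξ₀C
        exact lt_of_le_of_ne (hξ₀C y hy2) (Ne.symm (hcon y hy2 (by simpa using hy1))))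
    rw [mem_interior_iff_mem_nhds, Metric.mem_nhds_iff]
    refine ⟨d, hd, ?_⟩
    intro η hη
    rw [hC]
    intro y hy
    by_cases hy0 : y = 0
    · simp [hy0]
    have hn : 0 < ‖y‖ := norm_pos_iff.mpr hy0
    have h1 := hdle (‖y‖⁻¹ • y)
      ⟨by simp [norm_smul, hn.ne'], hcone _ (by positivity) y hy⟩
    simp only [inner_smul_right] at h1
    have h2 : d * ‖y‖ ≤ ⟪ξ₀, y⟫ := by
      rw [inv_mul_eq_div, le_div_iff₀ hn] at h1
      exact h1
    have h3 : |⟪η - ξ₀, y⟫| ≤ ‖η - ξ₀‖ * ‖y‖ := abs_real_inner_le_norm _ _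
    have h4 : ‖η - ξ₀‖ < d := by rwa [Metric.mem_ball, dist_eq_norm] at hη
    have h5 : ⟪η, y⟫ = ⟪ξ₀, y⟫ + ⟪η - ξ₀, y⟫ := by rw [inner_sub_left]; ring
    have h6 := (abs_le.mp h3).1
    have h7 : ‖η - ξ₀‖ * ‖y‖ ≤ d * ‖y‖ := by gcongr
    linarith
  obtain ⟨v, hvC, hv1, hv0⟩ := hv
  have hadd : ∀ x ∈ Cstar, ∀ y ∈ Cstar, x + y ∈ Cstar := by
    intro x hx y hy
    have h := hcone 2 (by norm_num) _
      (hconv hx hy (a := 1 / 2) (b := 1 / 2) (by norm_num) (by norm_num) (by norm_num))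
    rw [smul_add, smul_smul, smul_smul] at h
    norm_num at h
    exact h
  -- a small ball in the cone, near the origin
  have hball : ∃ p, ∃ r > 0, Metric.ball p r ⊆ Cstar ∩ {y | ⟪ξ₀, y⟫ < 1 / 4} := by
    have h0 : (0 : EuclideanSpace ℝ (Fin n)) ∈ closure (interior Cstar) := by
      rw [hconv.closure_interior_eq_closure_of_nonempty_interior hint]
      obtain ⟨p, hp⟩ := hint
      apply subset_closure
      simpa using hcone 0 le_rfl p (interior_subset hp)
    have ho : IsOpen {y : EuclideanSpace ℝ (Fin n) | ⟪ξ₀, y⟫ < 1 / 4} :=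
      isOpen_lt (by fun_prop) continuous_const
    obtain ⟨p, hp1, hp2⟩ := mem_closure_iff.mp h0 _ ho (by simp)
    obtain ⟨r, hr, hsub⟩ := Metric.isOpen_iff.mp (ho.inter isOpen_interior) p ⟨hp1, hp2⟩
    exact ⟨p, r, hr, fun y hy => ⟨interior_subset (hsub hy).2, (hsub hy).1⟩⟩
  obtain ⟨p, r, hr, hsub⟩ := hball
  rw [ENNReal.tendsto_nhds_top_iff_nnreal]
  intro M
  obtain ⟨N, hN⟩ := ENNReal.exists_nat_mul_gt
    (Metric.measure_ball_pos volume p hr).ne' (ENNReal.coe_ne_top (r := M))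
  set R : ℝ := ‖p‖ + r + 2 * r * N with hR
  have hRpos : 0 < R := by positivity
  have hev : ∀ᶠ k in atTop, dist (ξ k) ξ₀ < 1 / (4 * R) :=
    (Metric.tendsto_nhds.mp hlim) _ (by positivity)
  filter_upwards [hev] with k hk
  refine lt_of_lt_of_le hN ?_
  have hvol : volume (⋃ j ∈ Finset.range N, Metric.ball (p + (2 * r * (j : ℝ)) • v) r)
      = N * volume (Metric.ball p r) := by
    rw [measure_biUnion_finset]
    · simp [Measure.addHaar_ball_center]
    · intro i _ j _ hij
      apply Metric.ball_disjoint_ball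
      rw [dist_eq_norm, add_sub_add_left_eq_sub, ← sub_smul, norm_smul, hv1, mul_one,
        ← mul_sub, Real.norm_eq_abs, abs_mul, abs_of_pos (by positivity : 0 < 2 * r)]
      have : (1 : ℝ) ≤ |(i : ℝ) - j| := by
        have h : (1 : ℤ) ≤ |(i : ℤ) - j| := Int.one_le_abs (by omega)
        exact_mod_cast h
      nlinarith
    · intro i _
      exact measurableSet_ball
  rw [← hvol]
  apply measure_mono
  intro z hz
  simp only [Set.mem_iUnion, Finset.mem_range] at hz
  obtain ⟨j, hj, hz⟩ := hz
  have hjN : (j : ℝ) ≤ N := by exact_mod_cast hj.le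
  set t : ℝ := 2 * r * (j : ℝ) with ht
  have ht0 : 0 ≤ t := by positivity
  have htN : t ≤ 2 * r * N := by rw [ht]; gcongr
  have hzb : ‖z - t • v - p‖ < r := by
    rw [Metric.mem_ball, dist_eq_norm] at hz
    rwa [sub_sub, add_comm (t • v)]
  obtain ⟨hy1, hy2⟩ := hsub (show z - t • v ∈ Metric.ball p r by
    rwa [Metric.mem_ball, dist_eq_norm])
  have hy2' : ⟪ξ₀, z⟫ < 1 / 4 := by
    have : ⟪ξ₀, z - t • v⟫ < 1 / 4 := hy2
    rwa [inner_sub_right, inner_smul_right, hv0, mul_zero, sub_zero] at this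
  have hzn : ‖z‖ ≤ R := by
    have h1 : z = (z - t • v - p) + p + t • v := by abel
    have h2 : ‖z‖ ≤ ‖z - t • v - p‖ + ‖p‖ + ‖t • v‖ := by
      conv_lhs => rw [h1]
      exact norm_add₃_le
    rw [norm_smul, hv1, mul_one, Real.norm_eq_abs, abs_of_nonneg ht0] at h2
    linarith
  refine ⟨?_, ?_⟩
  · have := hadd _ hy1 _ (hcone t ht0 v hvC)
    rwa [sub_add_cancel] at this
  · have h3 : ⟪ξ k - ξ₀, z⟫ ≤ ‖ξ k - ξ₀‖ * ‖z‖ := real_inner_le_norm _ _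
    rw [dist_eq_norm] at hk
    have h4 : ‖ξ k - ξ₀‖ * ‖z‖ ≤ 1 / (4 * R) * R := by gcongr
    have h5 : 1 / (4 * R) * R = 1 / 4 := by field_simp
    rw [inner_sub_left] at h3
    linarith
end

section
/- There are infinitely many pairs (p, q) of positive integers with gcd(p, q) = 1 and q < p such that 4p² − 3q² is a perfect square. (For instance, for every odd integer b ≥ 5 not divisible by 3, the pair p = (b² + 3)/4, q = b is such a pair.) -/
theorem quasireg_aux (b : ℕ) (h5 : 5 ≤ b) (ho : Odd b) (h3 : ¬ (3 ∣ b)) :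
    (0 < (b ^ 2 + 3) / 4 ∧ 0 < b ∧ Nat.gcd ((b ^ 2 + 3) / 4) b = 1 ∧
          b < (b ^ 2 + 3) / 4 ∧
          ∃ m : ℕ, 4 * ((b ^ 2 + 3) / 4) ^ 2 = m ^ 2 + 3 * b ^ 2) := by
  obtain ⟨k, hk⟩ := ho
  obtain ⟨j, rfl⟩ : ∃ j, k = j + 2 := ⟨k - 2, by omega⟩
  have hp : (b ^ 2 + 3) / 4 = j ^ 2 + 5 * j + 7 := by
    have : b ^ 2 + 3 = 4 * (j ^ 2 + 5 * j + 7) := by subst hk; ring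
    omega
  have hg : 4 * (j ^ 2 + 5 * j + 7) = b * b + 3 := by subst hk; ring
  rw [hp]
  refine ⟨by positivity, by omega, ?_, by nlinarith, 2 * j ^ 2 + 10 * j + 11, by subst hk; ring⟩
  have h1 := Nat.gcd_dvd_left (j ^ 2 + 5 * j + 7) b
  have h2 := Nat.gcd_dvd_right (j ^ 2 + 5 * j + 7) b
  have hd : Nat.gcd (j ^ 2 + 5 * j + 7) b ∣ 3 := by
    have h4 := h1.mul_left 4
    rw [hg] at h4
    exact (Nat.dvd_add_right (h2.mul_left b)).1 h4
  rcases (Nat.dvd_prime Nat.prime_three).1 hd with h | h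
  · exact h
  · rw [h] at h2
    exact absurd h2 h3

/-- There are infinitely many pairs `(p, q)` of positive integers with
`gcd(p, q) = 1` and `q < p` such that `4p² − 3q²` is a perfect square (stated
subtraction-free as `4p² = m² + 3q²`). For instance, for every odd `b ≥ 5` not divisible
by `3`, the pair `p = (b² + 3)/4`, `q = b` is such a pair. These label the quasi-regular
Sasaki-Einstein manifolds `Y^{p,q}`. -/
theorem infinitely_many_quasiregular_Ypq :
    {pq : ℕ × ℕ | 0 < pq.1 ∧ 0 < pq.2 ∧ Nat.gcd pq.1 pq.2 = 1 ∧ pq.2 < pq.1 ∧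
        ∃ m : ℕ, 4 * pq.1 ^ 2 = m ^ 2 + 3 * pq.2 ^ 2}.Infinite ∧
      ∀ b : ℕ, 5 ≤ b → Odd b → ¬ (3 ∣ b) →
        (0 < (b ^ 2 + 3) / 4 ∧ 0 < b ∧ Nat.gcd ((b ^ 2 + 3) / 4) b = 1 ∧
          b < (b ^ 2 + 3) / 4 ∧
          ∃ m : ℕ, 4 * ((b ^ 2 + 3) / 4) ^ 2 = m ^ 2 + 3 * b ^ 2) := by
  refine ⟨?_, quasireg_aux⟩
  refine Set.infinite_of_injective_forall_mem
    (f := fun n : ℕ => (((6 * n + 5) ^ 2 + 3) / 4, 6 * n + 5)) ?_ ?_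
  · intro a c h
    have := (Prod.mk.inj h).2
    omega
  · intro n
    exact quasireg_aux (6 * n + 5) (by omega) ⟨3 * n + 2, by ring⟩ (by omega)
end
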